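/- Let N ≥ 5 and let V : (0,∞) → [0,∞] be measurable. Assume there exists R₂ > 0 such that V(r) < +∞ for almost every r > R₂ and λ_∞ := ess inf_{r>R₂} r^{γ_∞} V(r) > 0 for some γ_∞ ≤ 14/3. Then for every u ∈ H²_{V,r}(ℝ^N): |u(x)| ≤ c_∞ · λ_∞^{−1/4} · ‖u‖ / |x|^{(2(N−2)−γ_∞)/4} for almost every x with |x| > R₂, where c_∞ = σ_N^{−1/2} · (8/(N(2(N−2)−γ_∞)))^{1/4}. -/

import Mathlib

open MeasureTheory Filter Topology Set ENNReal

noncomputable section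

/-- Euclidean space `ℝ^N`. -/
abbrev E (N : ℕ) := EuclideanSpace ℝ (Fin N)

/-- The (classical) Laplacian of a function `φ : ℝ^N → ℝ`. -/
def lapl {N : ℕ} (φ : E N → ℝ) (x : E N) : ℝ :=
  ∑ i : Fin N, fderiv ℝ (fun y => fderiv ℝ φ y (EuclideanSpace.single i 1)) x
    (EuclideanSpace.single i 1)

/-- A function is radial if it depends only on the norm. -/
def IsRadial {N : ℕ} (u : E N → ℝ) : Prop := ∀ x y : E N, ‖x‖ = ‖y‖ → u x = u y

/-- The critical exponent `2** = 2N/(N-4)` as an element of `ℝ≥0∞`. -/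
def twoSS (N : ℕ) : ℝ≥0∞ := (2 * N : ℝ≥0∞) / ((N : ℝ≥0∞) - 4)

/-- `u ∈ D^{2,2}(ℝ^N)` with (distributional) Laplacian `w`: `u` lies in `L^{2**}`,
`w ∈ L²`, and `u` is the limit in `L^{2**}` of smooth compactly supported functions whose
Laplacians converge to `w` in `L²` (i.e. `u` lies in the closure of `C_c^∞` for the norm
`‖Δ·‖_{L²}`, with `Δu = w`). -/
def MemD22 (N : ℕ) (u w : E N → ℝ) : Prop :=
  MemLp u (twoSS N) volume ∧ MemLp w 2 volume ∧
  ∃ φ : ℕ → E N → ℝ,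
    (∀ n, ContDiff ℝ (⊤ : ℕ∞) (φ n) ∧ HasCompactSupport (φ n)) ∧
    Tendsto (fun n => eLpNorm (fun x => φ n x - u x) (twoSS N) volume) atTop (𝓝 0) ∧
    Tendsto (fun n => eLpNorm (fun x => lapl (φ n) x - w x) 2 volume) atTop (𝓝 0)

/-- `u ∈ H²_V(ℝ^N)` (with Laplacian `w`). -/
def MemH2V {N : ℕ} (V : ℝ → ℝ≥0∞) (u w : E N → ℝ) : Prop :=
  MemD22 N u w ∧ (∫⁻ x : E N, V ‖x‖ * ENNReal.ofReal ((u x) ^ 2)) < ⊤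

/-- `u ∈ H²_{V,r}(ℝ^N)`: member of `H²_V` which is radial. -/
def MemH2Vr {N : ℕ} (V : ℝ → ℝ≥0∞) (u w : E N → ℝ) : Prop :=
  MemH2V V u w ∧ IsRadial u

/-- The norm of `H²_V`: `‖u‖ = (∫ |Δu|² + V(|x|)u²)^{1/2}` (here `w = Δu`). -/
def H2norm {N : ℕ} (V : ℝ → ℝ≥0∞) (u w : E N → ℝ) : ℝ :=
  (((∫⁻ x : E N, ENNReal.ofReal ((w x) ^ 2)) +
    ∫⁻ x : E N, V ‖x‖ * ENNReal.ofReal ((u x) ^ 2)).toReal) ^ (1/2 : ℝ)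

/-- Hypothesis (V): `V : (0,∞) → [0,∞]` measurable and locally integrable on `(0,∞)`. -/
def HypV (V : ℝ → ℝ≥0∞) : Prop :=
  Measurable V ∧ ∀ a b : ℝ, 0 < a → (∫⁻ r in Set.Icc a b, V r) < ⊤

/-- Hypothesis (K): `K : (0,∞) → (0,∞)` measurable with `K ∈ L^s_loc((0,∞))`. -/
def HypK (K : ℝ → ℝ) (s : ℝ) : Prop :=
  (∀ r : ℝ, 0 < r → 0 < K r) ∧ Measurable K ∧ 1 < s ∧
  ∀ a b : ℝ, 0 < a → IntegrableOn (fun r => K r ^ s) (Set.Icc a b) volume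

/-- The quantity `S₀(q,R)`. -/
def S0 (N : ℕ) (V : ℝ → ℝ≥0∞) (K : ℝ → ℝ) (q R : ℝ) : ℝ≥0∞ :=
  ⨆ p : {p : (E N → ℝ) × (E N → ℝ) // MemH2Vr V p.1 p.2 ∧ H2norm V p.1 p.2 = 1},
    ∫⁻ x in Metric.ball (0 : E N) R, ENNReal.ofReal (K ‖x‖ * |p.1.1 x| ^ q)

/-- The quantity `S_∞(q,R)`. -/
def Sinf (N : ℕ) (V : ℝ → ℝ≥0∞) (K : ℝ → ℝ) (q R : ℝ) : ℝ≥0∞ :=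
  ⨆ p : {p : (E N → ℝ) × (E N → ℝ) // MemH2Vr V p.1 p.2 ∧ H2norm V p.1 p.2 = 1},
    ∫⁻ x in (Metric.ball (0 : E N) R)ᶜ, ENNReal.ofReal (K ‖x‖ * |p.1.1 x| ^ q)

/-- The quantity `R₀(q,R)`. -/
def R0 (N : ℕ) (V : ℝ → ℝ≥0∞) (K : ℝ → ℝ) (q R : ℝ) : ℝ≥0∞ :=
  ⨆ p : {p : ((E N → ℝ) × (E N → ℝ)) × ((E N → ℝ) × (E N → ℝ)) //
      MemH2Vr V p.1.1 p.1.2 ∧ MemH2Vr V p.2.1 p.2.2 ∧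
      H2norm V p.1.1 p.1.2 = 1 ∧ H2norm V p.2.1 p.2.2 = 1},
    ∫⁻ x in Metric.ball (0 : E N) R,
      ENNReal.ofReal (K ‖x‖ * |p.1.1.1 x| ^ (q - 1) * |p.1.2.1 x|)

/-- The quantity `R_∞(q,R)`. -/
def Rinf (N : ℕ) (V : ℝ → ℝ≥0∞) (K : ℝ → ℝ) (q R : ℝ) : ℝ≥0∞ :=
  ⨆ p : {p : ((E N → ℝ) × (E N → ℝ)) × ((E N → ℝ) × (E N → ℝ)) //
      MemH2Vr V p.1.1 p.1.2 ∧ MemH2Vr V p.2.1 p.2.2 ∧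
      H2norm V p.1.1 p.1.2 = 1 ∧ H2norm V p.2.1 p.2.2 = 1},
    ∫⁻ x in (Metric.ball (0 : E N) R)ᶜ,
      ENNReal.ofReal (K ‖x‖ * |p.1.1.1 x| ^ (q - 1) * |p.1.2.1 x|)

/-- The weighted measure `K(|x|)dx`. -/
def Kmeas (N : ℕ) (K : ℝ → ℝ) : Measure (E N) :=
  volume.withDensity (fun x => ENNReal.ofReal (K ‖x‖))

/-- Membership in the sum space `L^{q₁}_K + L^{q₂}_K`. -/
def MemSum (N : ℕ) (K : ℝ → ℝ) (q1 q2 : ℝ) (u : E N → ℝ) : Prop :=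
  ∃ u1 u2 : E N → ℝ, u = u1 + u2 ∧ MemLp u1 (ENNReal.ofReal q1) (Kmeas N K) ∧
    MemLp u2 (ENNReal.ofReal q2) (Kmeas N K)

/-- The norm of the sum space `L^{q₁}_K + L^{q₂}_K`. -/
def sumNorm (N : ℕ) (K : ℝ → ℝ) (q1 q2 : ℝ) (u : E N → ℝ) : ℝ≥0∞ :=
  ⨅ p : {p : (E N → ℝ) × (E N → ℝ) // u = p.1 + p.2},
    max (eLpNorm p.1.1 (ENNReal.ofReal q1) (Kmeas N K))
        (eLpNorm p.1.2 (ENNReal.ofReal q2) (Kmeas N K))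

/-- `σ_N`, the (N-1)-dimensional measure of the unit sphere, i.e. `N·ω_N`. -/
def sigmaN (N : ℕ) : ℝ := N * (volume (Metric.ball (0 : E N) 1)).toReal

end

lemma sig_polar {N : ℕ} (hN : 5 ≤ N) (f : ℝ → ℝ) :
    ∫ x : E N, f ‖x‖ = sigmaN N * ∫ y in Ioi (0:ℝ), y ^ (N - 1) * f y := by
  have : NeZero N := ⟨by omega⟩
  have h := integral_fun_norm_addHaar (volume : Measure (E N)) f
  simp only [finrank_euclideanSpace, Fintype.card_fin, smul_eq_mul, nsmul_eq_mul] at h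
  rw [h, sigmaN, Measure.real, mul_assoc]

lemma sig_integrable {N : ℕ} (hN : 5 ≤ N) (f : ℝ → ℝ) :
    Integrable (fun x : E N => f ‖x‖) ↔
      IntegrableOn (fun y : ℝ => y ^ (N - 1) * f y) (Ioi 0) := by
  have : NeZero N := ⟨by omega⟩
  have h := integrable_fun_norm_addHaar (volume : Measure (E N)) (f := f)
  simpa only [finrank_euclideanSpace, Fintype.card_fin, smul_eq_mul] using h

lemma sigmaN_pos {N : ℕ} (hN : 5 ≤ N) : 0 < sigmaN N := by
  unfold sigmaN
  have : 0 < (volume (Metric.ball (0 : E N) 1)).toReal :=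
    ENNReal.toReal_pos (Metric.measure_ball_pos _ _ one_pos).ne' measure_ball_lt_top.ne
  positivity

lemma ae_norm {N : ℕ} (hN : 5 ≤ N) (p : ℝ → Prop) (hp : ∀ᵐ r : ℝ, 0 < r → p r) :
    ∀ᵐ x : E N, p ‖x‖ := by
  classical
  set f : ℝ → ℝ := fun r => if p r then 0 else 1 with hf
  have h0 : (fun y : ℝ => y ^ (N - 1) * f y) =ᵐ[volume.restrict (Ioi 0)] 0 := by
    rw [Filter.EventuallyEq, ae_restrict_iff' measurableSet_Ioi]
    filter_upwards [hp] with r hr hr0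
    simp [hf, hr hr0]
  have hfint : Integrable (fun x : E N => f ‖x‖) := by
    rw [sig_integrable hN]
    exact (integrable_zero _ _ _).congr h0.symm
  have hz : ∫ x : E N, f ‖x‖ = 0 := by
    rw [sig_polar hN, integral_congr_ae h0]; simp
  rw [integral_eq_zero_iff_of_nonneg (fun x => by simp only [hf]; split_ifs <;> simp) hfint] at hz
  filter_upwards [hz] with x hx
  by_contra hc
  simp [hf, hc] at hx

lemma conv_test {N : ℕ} (p : ℝ≥0∞) (hp : 1 ≤ p) (f : ℕ → E N → ℝ) (g K : E N → ℝ)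
    (hf : ∀ n, Continuous (f n)) (hg : MemLp g p volume)
    (hlim : Tendsto (fun n => eLpNorm (fun x => f n x - g x) p volume) atTop (𝓝 0))
    (hK : Continuous K) (hKc : HasCompactSupport K) :
    Tendsto (fun n => ∫ x, f n x * K x) atTop (𝓝 (∫ x, g x * K x)) := by
  obtain ⟨C, hC⟩ := hKc.exists_bound_of_continuous hK
  set S := tsupport K with hS
  have hSc : IsCompact S := hKc
  have hSm : MeasurableSet S := hSc.isClosed.measurableSet
  have hfin : volume S < ⊤ := hSc.measure_lt_top
  have : IsFiniteMeasure (volume.restrict S) := ⟨by simpa using hfin⟩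
  have hgl : LocallyIntegrable g volume := hg.locallyIntegrable hp
  have hgi : Integrable (fun x => g x * K x) := by
    simpa [mul_comm, smul_eq_mul] using hgl.integrable_smul_left_of_hasCompactSupport hK hKc
  have hfi : ∀ n, Integrable (fun x => f n x * K x) := fun n =>
    ((hf n).mul hK).integrable_of_hasCompactSupport hKc.mul_left
  refine tendsto_integral_of_L1' _ hgi.1 (Eventually.of_forall hfi) ?_
  have key : ∀ n, eLpNorm ((fun x => f n x * K x) - fun x => g x * K x) 1 volume ≤
      ENNReal.ofReal C * (eLpNorm (fun x => f n x - g x) p volume *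
        volume S ^ (1 / (1:ℝ≥0∞).toReal - 1 / p.toReal)) := by
    intro n
    have hm : AEStronglyMeasurable (fun x => f n x - g x) volume :=
      (hf n).aestronglyMeasurable.sub hg.1
    have e1 : ((fun x => f n x * K x) - fun x => g x * K x) =
        S.indicator (fun x => K x * (f n x - g x)) := by
      ext x
      by_cases hx : x ∈ S
      · simp [hx]; ring
      · simp [hx, image_eq_zero_of_notMem_tsupport hx]
    rw [e1, eLpNorm_indicator_eq_eLpNorm_restrict hSm]
    calc _ ≤ ENNReal.ofReal C * eLpNorm (fun x => f n x - g x) 1 (volume.restrict S) := by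
          apply eLpNorm_le_mul_eLpNorm_of_ae_le_mul
          refine Eventually.of_forall fun x => ?_
          rw [norm_mul]
          exact mul_le_mul_of_nonneg_right (hC x) (norm_nonneg _)
      _ ≤ _ := by
          gcongr
          refine (eLpNorm_le_eLpNorm_mul_rpow_measure_univ hp hm.restrict).trans ?_
          rw [Measure.restrict_apply_univ]
          gcongr
          exact Measure.restrict_le_self
  have hz : Tendsto (fun n => ENNReal.ofReal C * (eLpNorm (fun x => f n x - g x) p volume *
        volume S ^ (1 / (1:ℝ≥0∞).toReal - 1 / p.toReal))) atTop (𝓝 0) := by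
    have hne : volume S ^ (1 / (1:ℝ≥0∞).toReal - 1 / p.toReal) ≠ ⊤ := by
      refine (ENNReal.rpow_lt_top_of_nonneg ?_ hfin.ne).ne
      rcases eq_or_ne p ⊤ with h | h
      · simp [h]
      · have : 1 ≤ p.toReal := by
          simpa using ENNReal.toReal_mono h hp
        simp only [ENNReal.toReal_one, div_one, sub_nonneg]
        rw [div_le_one (by linarith)]; exact this
    have h1 := ENNReal.Tendsto.mul_const hlim (b := volume S ^ (1 / (1:ℝ≥0∞).toReal - 1 / p.toReal))
      (Or.inr hne)
    have h2 := ENNReal.Tendsto.const_mul h1 (a := ENNReal.ofReal C) (Or.inr ENNReal.ofReal_ne_top)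
    simpa using h2
  exact tendsto_of_tendsto_of_tendsto_of_le_of_le tendsto_const_nhds hz (fun _ => zero_le) key

lemma pd_smooth {N : ℕ} {φ : E N → ℝ} (hφ : ContDiff ℝ (⊤ : ℕ∞) φ) (v : E N) :
    ContDiff ℝ (⊤ : ℕ∞) (fun y => fderiv ℝ φ y v) := by
  have : ContDiff ℝ (⊤ : ℕ∞) (fderiv ℝ φ) := hφ.fderiv_right (by simp)
  exact this.clm_apply contDiff_const

lemma pd_supp {N : ℕ} {φ : E N → ℝ} (hφ : HasCompactSupport φ) (v : E N) :
    HasCompactSupport (fun y => fderiv ℝ φ y v) := hφ.fderiv_apply ℝ v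

lemma ibp1 {N : ℕ} {φ ψ : E N → ℝ} (hφ : ContDiff ℝ (⊤ : ℕ∞) φ) (hφc : HasCompactSupport φ)
    (hψ : ContDiff ℝ (⊤ : ℕ∞) ψ) (v : E N) :
    ∫ x, φ x * fderiv ℝ ψ x v = - ∫ x, fderiv ℝ φ x v * ψ x := by
  apply integral_mul_fderiv_eq_neg_fderiv_mul_of_integrable
  · exact ((pd_smooth hφ v).continuous.mul hψ.continuous).integrable_of_hasCompactSupport
      (pd_supp hφc v).mul_right
  · exact (hφ.continuous.mul (pd_smooth hψ v).continuous).integrable_of_hasCompactSupport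
      hφc.mul_right
  · exact (hφ.continuous.mul hψ.continuous).integrable_of_hasCompactSupport
      hφc.mul_right
  · exact fun x _ => hφ.differentiable (by simp) x
  · exact fun x _ => hψ.differentiable (by simp) x

lemma lapl_cont {N : ℕ} {φ : E N → ℝ} (hφ : ContDiff ℝ (⊤ : ℕ∞) φ) : Continuous (lapl φ) := by
  unfold lapl
  exact continuous_finsetSum _ fun i _ => (pd_smooth (pd_smooth hφ _) _).continuous

lemma lapl_supp {N : ℕ} {φ : E N → ℝ} (hφ : HasCompactSupport φ) : HasCompactSupport (lapl φ) := by
  refine HasCompactSupport.of_support_subset_isCompact hφ ?_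
  intro x hx
  by_contra hc
  apply hx
  unfold lapl
  refine Finset.sum_eq_zero fun i _ => ?_
  have h1 : x ∉ tsupport (fun y => fderiv ℝ (fun y => fderiv ℝ φ y (EuclideanSpace.single i 1)) y
    (EuclideanSpace.single i 1)) := fun h =>
      hc (tsupport_fderiv_apply_subset ℝ _ (tsupport_fderiv_apply_subset ℝ _ h))
  exact image_eq_zero_of_notMem_tsupport (f := fun y => fderiv ℝ (fun y => fderiv ℝ φ y
    (EuclideanSpace.single i 1)) y (EuclideanSpace.single i 1)) h1

lemma ibp2 {N : ℕ} {φ ψ : E N → ℝ} (hφ : ContDiff ℝ (⊤ : ℕ∞) φ) (hφc : HasCompactSupport φ)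
    (hψ : ContDiff ℝ (⊤ : ℕ∞) ψ) :
    ∫ x, φ x * lapl ψ x = ∫ x, lapl φ x * ψ x := by
  unfold lapl
  simp_rw [Finset.mul_sum, Finset.sum_mul]
  rw [integral_finsetSum, integral_finsetSum]
  · refine Finset.sum_congr rfl fun i _ => ?_
    rw [ibp1 hφ hφc (pd_smooth hψ _), ibp1 (pd_smooth hφ _) (pd_supp hφc _) hψ, neg_neg]
  · exact fun i _ => ((pd_smooth (pd_smooth hφ _) _).continuous.mul
      hψ.continuous).integrable_of_hasCompactSupport (pd_supp (pd_supp hφc _) _).mul_right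
  · exact fun i _ => (hφ.continuous.mul (pd_smooth (pd_smooth hψ _) _).continuous
      ).integrable_of_hasCompactSupport hφc.mul_right

lemma twoSS_one_le {N : ℕ} (hN : 5 ≤ N) : 1 ≤ twoSS N := by
  unfold twoSS
  obtain ⟨k, rfl⟩ := Nat.exists_eq_add_of_le hN
  have e : (((5 + k : ℕ) : ℝ≥0∞) - 4) = ((1 + k : ℕ) : ℝ≥0∞) := by
    have : ((5 + k : ℕ) : ℝ≥0∞) - ((4 : ℕ) : ℝ≥0∞) = ((5 + k - 4 : ℕ) : ℝ≥0∞) :=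
      (ENNReal.natCast_sub _ _).symm
    rw [show 5 + k - 4 = 1 + k by omega] at this
    exact_mod_cast this
  rw [e, ENNReal.le_div_iff_mul_le (Or.inl (by simp)) (Or.inl (ENNReal.natCast_ne_top _)), one_mul]
  have : 1 + k ≤ 2 * (5 + k) := by omega
  exact_mod_cast this

lemma weak_lapl {N : ℕ} (hN : 5 ≤ N) {u w ψ : E N → ℝ} (h : MemD22 N u w)
    (hψ : ContDiff ℝ (⊤ : ℕ∞) ψ) (hψc : HasCompactSupport ψ) :
    ∫ x, u x * lapl ψ x = ∫ x, w x * ψ x := by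
  obtain ⟨hu, hw, φ, hφ, h1, h2⟩ := h
  have c1 := conv_test (twoSS N) (twoSS_one_le hN) φ u (lapl ψ) (fun n => (hφ n).1.continuous) hu h1
    (lapl_cont hψ) (lapl_supp hψc)
  have c2 := conv_test 2 (by norm_num) (fun n => lapl (φ n)) w ψ
    (fun n => lapl_cont (hφ n).1) hw h2 hψ.continuous hψc
  have e : (fun n => ∫ x, φ n x * lapl ψ x) = fun n => ∫ x, lapl (φ n) x * ψ x :=
    funext fun n => ibp2 (hφ n).1 (hφ n).2 hψ
  rw [e] at c1
  exact tendsto_nhds_unique c1 c2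

lemma lapl_radial {N : ℕ} (g k k' : ℝ → ℝ) (hg : ∀ t, HasDerivAt g (k t) t)
    (hk : ∀ t, HasDerivAt k (k' t) t) (x : E N) :
    lapl (fun y : E N => g (‖y‖ ^ 2)) x = 2 * N * k (‖x‖ ^ 2) + 4 * ‖x‖ ^ 2 * k' (‖x‖ ^ 2) := by
  have hn : ∀ y : E N, HasFDerivAt (fun y : E N => ‖y‖ ^ 2) (2 • innerSL ℝ y) y := fun y =>
    (hasStrictFDerivAt_norm_sq y).hasFDerivAt
  have h1 : ∀ (i : Fin N) (y : E N), fderiv ℝ (fun y : E N => g (‖y‖ ^ 2)) y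
      (EuclideanSpace.single i 1) = 2 * y i * k (‖y‖ ^ 2) := by
    intro i y
    have := (hg (‖y‖ ^ 2)).comp_hasFDerivAt y (hn y)
    rw [show (fun y : E N => g (‖y‖ ^ 2)) = g ∘ fun y : E N => ‖y‖ ^ 2 from rfl, this.fderiv]
    simp [EuclideanSpace.inner_single_right]
    ring
  unfold lapl
  simp_rw [h1]
  have h2 : ∀ i : Fin N, fderiv ℝ (fun y : E N => 2 * y i * k (‖y‖ ^ 2)) x
      (EuclideanSpace.single i 1) = 2 * k (‖x‖ ^ 2) + 4 * (x i) ^ 2 * k' (‖x‖ ^ 2) := by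
    intro i
    have a := (hk (‖x‖ ^ 2)).comp_hasFDerivAt x (hn x)
    have b : HasFDerivAt (fun y : E N => 2 * y i)
        ((2:ℝ) • (EuclideanSpace.proj i : E N →L[ℝ] ℝ)) x :=
      ((EuclideanSpace.proj i : E N →L[ℝ] ℝ).hasFDerivAt).const_mul 2
    have c := b.mul a
    rw [show (fun y : E N => 2 * y i * k (‖y‖ ^ 2)) =
      (fun y : E N => 2 * y i) * (k ∘ fun y : E N => ‖y‖ ^ 2) from rfl, c.fderiv]
    simp [EuclideanSpace.inner_single_right]
    ring
  simp_rw [h2]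
  have h3 : ∑ i, 4 * x i ^ 2 = 4 * ‖x‖ ^ 2 := by
    rw [EuclideanSpace.real_norm_sq_eq, Finset.mul_sum]
  rw [Finset.sum_add_distrib, ← Finset.sum_mul _ _ (k' (‖x‖ ^ 2)), h3]
  simp
  ring

lemma supp_ab {η : ℝ → ℝ} (hc : HasCompactSupport η) (hs : tsupport η ⊆ Ioi 0) :
    ∃ a b : ℝ, 0 < a ∧ a < b ∧ (∀ r, r ≤ a → η r = 0) ∧ (∀ r, b ≤ r → η r = 0) := by
  have hc' : IsCompact (tsupport η) := hc
  rcases (tsupport η).eq_empty_or_nonempty with he | hne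
  · refine ⟨1, 2, one_pos, by norm_num, fun r _ => ?_, fun r _ => ?_⟩ <;>
    exact image_eq_zero_of_notMem_tsupport (by simp [he])
  · obtain ⟨m, hm⟩ := hc'.exists_isLeast hne
    obtain ⟨M, hM⟩ := hc'.exists_isGreatest hne
    have h0 : 0 < m := hs hm.1
    have h1 : m ≤ M := hM.2 hm.1
    refine ⟨m / 2, M + 1, by linarith, by linarith, fun r hr => ?_, fun r hr => ?_⟩
    · exact image_eq_zero_of_notMem_tsupport fun h => by have := hm.2 h; linarith
    · exact image_eq_zero_of_notMem_tsupport fun h => by have := hM.2 h; linarith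

/-- integral of `w` over the ball of radius `s` -/
noncomputable def ballInt {N : ℕ} (w : E N → ℝ) (s : ℝ) : ℝ := ∫ x in Metric.ball (0 : E N) s, w x

lemma ballInt_cont {N : ℕ} (hN : 5 ≤ N) {w : E N → ℝ} (hw : MemLp w 2 volume) :
    Continuous (ballInt w) := by
  have : NeZero N := ⟨by omega⟩
  have hnt : Nontrivial (E N) := inferInstance
  have hl : LocallyIntegrable w volume := hw.locallyIntegrable (by norm_num)
  rw [continuous_iff_continuousAt]
  intro s0
  have e : ballInt w = fun s => ∫ x, (Metric.ball (0 : E N) s).indicator w x := by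
    ext s; rw [integral_indicator measurableSet_ball]; rfl
  rw [e]
  have hi : Integrable ((Metric.closedBall (0 : E N) (s0 + 1)).indicator w) :=
    (hl.integrableOn_isCompact (isCompact_closedBall _ _)).integrable_indicator
      measurableSet_closedBall
  refine tendsto_integral_filter_of_dominated_convergence
    (fun x => ‖(Metric.closedBall (0 : E N) (s0 + 1)).indicator w x‖) ?_ ?_ hi.norm ?_
  · exact Eventually.of_forall fun s => hw.1.indicator measurableSet_ball
  · filter_upwards [gt_mem_nhds (show s0 < s0 + 1 by linarith)] with s hs
    refine Eventually.of_forall fun x => ?_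
    apply norm_indicator_le_of_subset
    exact Metric.ball_subset_closedBall.trans (Metric.closedBall_subset_closedBall hs.le)
  · have hsph : ∀ᵐ x : E N, x ∉ Metric.sphere (0 : E N) s0 := by
      rw [ae_iff]
      simpa only [not_not, ofPred_mem_eq] using Measure.addHaar_sphere volume (0 : E N) s0
    filter_upwards [hsph] with x hx
    have hne : ‖x‖ ≠ s0 := by simpa using hx
    rcases lt_or_gt_of_ne hne with h | h
    · refine tendsto_const_nhds.congr' ?_
      filter_upwards [lt_mem_nhds h] with s hs
      simp [indicator, h, hs]
    · refine tendsto_const_nhds.congr' ?_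
      filter_upwards [gt_mem_nhds h] with s hs
      simp [indicator, h.le.not_gt, (le_of_lt hs).not_gt]

lemma fubini_ball {N : ℕ} {w : E N → ℝ} (hw : MemLp w 2 volume) (m : ℝ → ℝ)
    (hm : Continuous m) (hmc : HasCompactSupport m) (b : ℝ) (hb : ∀ s, b ≤ s → m s = 0) :
    ∫ x : E N, w x * (∫ s in Ioi ‖x‖, m s) = ∫ s in Ioi (0:ℝ), m s * ballInt w s := by
  have hl : LocallyIntegrable w volume := hw.locallyIntegrable (by norm_num)
  set w' : E N → ℝ := (Metric.closedBall (0 : E N) b).indicator w with hw'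
  have hi : Integrable w' :=
    (hl.integrableOn_isCompact (isCompact_closedBall _ _)).integrable_indicator
      measurableSet_closedBall
  have hmi : Integrable m := hm.integrable_of_hasCompactSupport hmc
  set S : Set (E N × ℝ) := {p | ‖p.1‖ < p.2} with hS
  have hSm : MeasurableSet S := measurableSet_lt (by fun_prop) (by fun_prop)
  have hP : Integrable (S.indicator (fun p : E N × ℝ => w' p.1 * m p.2))
      ((volume : Measure (E N)).prod (volume : Measure ℝ)) :=
    (hi.mul_prod hmi).indicator hSm
  have hsw := integral_integral_swap
    (f := fun (x : E N) (s : ℝ) => S.indicator (fun p : E N × ℝ => w' p.1 * m p.2) (x, s)) hP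
  have key : ∀ x s, S.indicator (fun p : E N × ℝ => w' p.1 * m p.2) (x, s) =
      if ‖x‖ < s then w x * m s else 0 := by
    intro x s
    by_cases h : ‖x‖ < s
    · by_cases h2 : ‖x‖ ≤ b
      · simp [hS, hw', indicator, h, h2]
      · simp [hS, hw', indicator, h, h2, hb s (by linarith [not_le.1 h2])]
    · simp [hS, h]
  simp_rw [key] at hsw
  calc _ = ∫ x : E N, ∫ s : ℝ, if ‖x‖ < s then w x * m s else 0 := by
        congr 1; ext x
        rw [← integral_const_mul, ← integral_indicator measurableSet_Ioi]
        congr 1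
      _ = _ := hsw
      _ = ∫ s : ℝ, (Ioi (0:ℝ)).indicator (fun s => m s * ballInt w s) s := by
        congr 1; ext s
        by_cases hs : 0 < s
        · rw [indicator_of_mem (mem_Ioi.2 hs), ballInt, ← integral_const_mul,
            ← integral_indicator measurableSet_ball]
          congr 1; ext x
          by_cases h : ‖x‖ < s <;> simp [indicator, h, mul_comm]
        · rw [indicator_of_notMem (by simpa using hs)]
          have : ∀ x : E N, ¬ ‖x‖ < s := fun x h => hs ((norm_nonneg x).trans_lt h)
          simp [this]
      _ = _ := integral_indicator measurableSet_Ioi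

lemma weak_deriv {N : ℕ} (hN : 5 ≤ N) {u w : E N → ℝ} (h : MemD22 N u w) (U : ℝ → ℝ)
    (hU : ∀ x, u x = U ‖x‖) {η : ℝ → ℝ} (hη : ContDiff ℝ (⊤ : ℕ∞) η) (hc : HasCompactSupport η)
    (hs : tsupport η ⊆ Ioi 0) :
    ∫ r in Ioi (0:ℝ), U r * deriv η r =
      - ∫ r in Ioi (0:ℝ), ((sigmaN N)⁻¹ * (r ^ (N - 1))⁻¹ * ballInt w r) * η r := by
  obtain ⟨a, b, ha, hab, hηa, hηb⟩ := supp_ab hc hs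
  have hb : 0 < b := ha.trans hab
  set k : ℝ → ℝ := fun t => (Real.sqrt t ^ N)⁻¹ * η (Real.sqrt t) with hk
  have hksm : ContDiff ℝ (⊤ : ℕ∞) k := by
    rw [contDiff_iff_contDiffAt]
    intro t
    rcases le_or_gt t 0 with ht | ht
    · have : k =ᶠ[𝓝 t] fun _ => 0 := by
        filter_upwards [gt_mem_nhds (lt_of_le_of_lt ht (pow_pos ha 2))] with s hs
        have : Real.sqrt s ≤ a := (Real.sqrt_le_left ha.le).2 hs.le
        simp [hk, hηa _ this]
      exact contDiffAt_const.congr_of_eventuallyEq this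
    · have h1 : ContDiffAt ℝ (⊤ : ℕ∞) Real.sqrt t := Real.contDiffAt_sqrt ht.ne'
      have h2 : Real.sqrt t ^ N ≠ 0 := (pow_pos (Real.sqrt_pos.2 ht) N).ne'
      exact ((h1.pow N).inv h2).mul (hη.contDiffAt.comp t h1)
  have hkb : ∀ t, b ^ 2 ≤ t → k t = 0 := by
    intro t ht
    have : b ≤ Real.sqrt t := Real.le_sqrt_of_sq_le ht
    simp [hk, hηb _ this]
  have hkd : ∀ t, HasDerivAt k (deriv k t) t := fun t =>
    (hksm.differentiable (by simp) t).hasDerivAt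
  set g : ℝ → ℝ := fun t => ∫ s in (b ^ 2)..t, k s with hg
  have hgd : ∀ t, HasDerivAt g (k t) t := fun t =>
    intervalIntegral.integral_hasDerivAt_right (hksm.continuous.intervalIntegrable _ _)
      (hksm.continuous.stronglyMeasurableAtFilter _ _) hksm.continuous.continuousAt
  have hgsm : ContDiff ℝ (⊤ : ℕ∞) g := by
    rw [contDiff_infty_iff_deriv]
    refine ⟨fun t => (hgd t).differentiableAt, ?_⟩
    rw [show deriv g = k from funext fun t => (hgd t).deriv]
    exact hksm
  have hψsm : ContDiff ℝ (⊤ : ℕ∞) (fun x : E N => g (‖x‖ ^ 2)) := hgsm.comp (contDiff_norm_sq ℝ)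
  have hgb : ∀ t, b ^ 2 ≤ t → g t = 0 := by
    intro t ht
    simp only [hg]
    rw [intervalIntegral.integral_congr (g := fun _ => 0), intervalIntegral.integral_zero]
    intro s hs
    rw [uIcc_of_le ht] at hs
    exact hkb s hs.1
  have hψc : HasCompactSupport (fun x : E N => g (‖x‖ ^ 2)) := by
    refine HasCompactSupport.of_support_subset_isCompact (isCompact_closedBall (0 : E N) b) ?_
    intro x hx
    by_contra hcx
    apply hx
    refine hgb _ ?_
    have : b < ‖x‖ := by simpa using hcx
    gcongr
  have hweak := weak_lapl hN h hψsm hψc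
  -- left side
  have hηk : ∀ r, 0 < r → η r = r ^ N * k (r ^ 2) := by
    intro r hr
    simp only [hk, Real.sqrt_sq hr.le]
    field_simp
  have hηd : ∀ r, 0 < r → deriv η r = N * r ^ (N - 1) * k (r ^ 2)
      + r ^ N * (deriv k (r ^ 2) * (2 * r)) := by
    intro r hr
    have h1 : HasDerivAt (fun r : ℝ => r ^ N * k (r ^ 2)) (N * r ^ (N - 1) * k (r ^ 2)
      + r ^ N * (deriv k (r ^ 2) * (2 * r))) r := by
      have h2 : HasDerivAt (fun r : ℝ => r ^ 2) (2 * r) r := by simpa using hasDerivAt_pow 2 r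
      have h3 : HasDerivAt (fun r : ℝ => k (r ^ 2)) (deriv k (r ^ 2) * (2 * r)) r :=
        HasDerivAt.comp (h₂ := k) r (hkd (r ^ 2)) h2
      exact (hasDerivAt_pow N r).mul h3
    refine (h1.congr_of_eventuallyEq ?_).deriv
    filter_upwards [lt_mem_nhds hr] with s hs using hηk s hs
  have hL : ∫ x, u x * lapl (fun x : E N => g (‖x‖ ^ 2)) x =
      sigmaN N * (2 * ∫ r in Ioi (0:ℝ), U r * deriv η r) := by
    simp_rw [lapl_radial g k (deriv k) hgd hkd, hU]
    rw [sig_polar hN (fun r => U r * (2 * N * k (r ^ 2) + 4 * r ^ 2 * deriv k (r ^ 2)))]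
    congr 1
    rw [← integral_const_mul]
    refine setIntegral_congr_fun measurableSet_Ioi fun r hr => ?_
    rw [hηd r hr]
    obtain ⟨n, rfl⟩ : ∃ n, N = n + 1 := ⟨N - 1, by omega⟩
    simp only [Nat.add_sub_cancel]
    ring
  -- right side
  set m : ℝ → ℝ := fun s => 2 * s * k (s ^ 2) with hm
  have hmcont : Continuous m := by
    have := hksm.continuous
    fun_prop
  have hmb : ∀ s, b ≤ s → m s = 0 := by
    intro s hs
    simp [hm, hkb (s ^ 2) (by gcongr)]
  have hmc : HasCompactSupport m := by
    refine HasCompactSupport.of_support_subset_isCompact (isCompact_Icc (a := -b) (b := b)) ?_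
    intro s hs
    by_contra hcs
    apply hs
    have : b ^ 2 ≤ s ^ 2 := by
      rw [mem_Icc, ← abs_le, not_le] at hcs
      rw [← sq_abs s]; gcongr
    simp [hm, hkb _ this]
  have hmi : Integrable m := hmcont.integrable_of_hasCompactSupport hmc
  have hgm : ∀ r, g (r ^ 2) = - ∫ s in Ioi r, m s := by
    intro r
    have h1 : ∫ s in Ioi r, m s = ∫ s in r..b, m s := by
      have h2 := intervalIntegral.integral_Ioi_sub_Ioi' (a := r) (b := b) (f := m) (μ := volume)
        hmi.integrableOn hmi.integrableOn
      have h3 : ∫ s in Ioi b, m s = 0 :=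
        setIntegral_eq_zero_of_forall_eq_zero fun s hs => hmb s (le_of_lt hs)
      rw [h3, sub_zero] at h2
      exact h2
    have h4 : ∫ s in r..b, m s = ∫ t in (r ^ 2)..(b ^ 2), k t := by
      rw [← intervalIntegral.integral_comp_mul_deriv (f := fun s : ℝ => s ^ 2)
        (f' := fun s => 2 * s) (g := k)]
      · refine intervalIntegral.integral_congr fun s _ => ?_
        simp only [hm, Function.comp]; ring
      · intro s _; simpa using hasDerivAt_pow 2 s
      · fun_prop
      · exact hksm.continuous
    rw [h1, h4, ← intervalIntegral.integral_symm]
  have hR : ∫ x, w x * g (‖x‖ ^ 2) = - (2 * ∫ r in Ioi (0:ℝ),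
      ((r ^ (N - 1))⁻¹ * ballInt w r) * η r) := by
    simp_rw [hgm, mul_neg]
    rw [integral_neg, fubini_ball h.2.1 m hmcont hmc b hmb, ← integral_const_mul]
    congr 1
    refine setIntegral_congr_fun measurableSet_Ioi fun r hr => ?_
    have hr' : (0:ℝ) < r := hr
    simp only [hm]
    rw [hηk r hr]
    obtain ⟨n, rfl⟩ : ∃ n, N = n + 1 := ⟨N - 1, by omega⟩
    simp only [Nat.add_sub_cancel]
    field_simp
    ring
  rw [hL, hR] at hweak
  have hσ := sigmaN_pos hN
  simp_rw [mul_assoc (sigmaN N)⁻¹, integral_const_mul]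
  field_simp
  field_simp at hweak
  linarith

lemma test_int {D ζ : ℝ → ℝ} (hD : LocallyIntegrableOn D (Ioi 0)) (hζ : Continuous ζ) {a b : ℝ}
    (ha : 0 < a) (hζa : ∀ r, r ≤ a → ζ r = 0) (hζb : ∀ r, b ≤ r → ζ r = 0) :
    IntegrableOn (fun r => D r * ζ r) (Ioi 0) := by
  have h1 : IntegrableOn D (Icc a b) :=
    hD.integrableOn_compact_subset (fun r hr => lt_of_lt_of_le ha hr.1) isCompact_Icc
  have h2 : IntegrableOn (fun r => D r * ζ r) (Icc a b) :=
    h1.mul_continuousOn hζ.continuousOn isCompact_Icc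
  refine h2.of_forall_sdiff_eq_zero measurableSet_Ioi fun r hr => ?_
  have h3 := hr.2
  simp only [mem_Icc, not_and_or, not_le] at h3
  rcases h3 with h | h
  · simp [hζa r h.le]
  · simp [hζb r h.le]

lemma set_to_interval {f : ℝ → ℝ} {a b : ℝ} (ha : 0 < a) (hab : a ≤ b)
    (hfa : ∀ r, r ≤ a → f r = 0) (hfb : ∀ r, b ≤ r → f r = 0) :
    ∫ r in Ioi (0:ℝ), f r = ∫ r in a..b, f r := by
  rw [intervalIntegral.integral_of_le hab]
  refine setIntegral_eq_of_subset_of_forall_sdiff_eq_zero measurableSet_Ioi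
    (fun r hr => ha.trans hr.1) fun r hr => ?_
  have h3 := hr.2
  simp only [mem_Ioc, not_and_or, not_le, not_lt] at h3
  rcases h3 with h | h
  · exact hfa r h
  · exact hfb r h.le

lemma dbr {U h : ℝ → ℝ} (hU : LocallyIntegrableOn U (Ioi 0)) (hh : ContinuousOn h (Ioi 0))
    (hw : ∀ η : ℝ → ℝ, ContDiff ℝ (⊤ : ℕ∞) η → HasCompactSupport η → tsupport η ⊆ Ioi 0 →
      ∫ r in Ioi (0:ℝ), U r * deriv η r = - ∫ r in Ioi (0:ℝ), h r * η r) :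
    ∃ F : ℝ → ℝ, (∀ r, 0 < r → HasDerivAt F (h r) r) ∧ ∀ᵐ r : ℝ, 0 < r → U r = F r := by
  set P : ℝ → ℝ := fun r => ∫ s in (1:ℝ)..r, h s with hP
  have hii : ∀ a b : ℝ, 0 < a → 0 < b → IntervalIntegrable h volume a b := fun a b ha hb =>
    (hh.mono fun s hs => lt_of_lt_of_le (lt_min ha hb) hs.1).intervalIntegrable
  have hPd : ∀ r, 0 < r → HasDerivAt P (h r) r := fun r hr =>
    intervalIntegral.integral_hasDerivAt_right (hii 1 r one_pos hr)
      (hh.stronglyMeasurableAtFilter isOpen_Ioi r hr) (hh.continuousAt (Ioi_mem_nhds hr))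
  have hPc : ContinuousOn P (Ioi 0) := fun r hr => (hPd r hr).continuousAt.continuousWithinAt
  set D : ℝ → ℝ := fun r => U r - P r with hDdef
  have hPl : LocallyIntegrableOn P (Ioi 0) := hPc.locallyIntegrableOn measurableSet_Ioi
  have hDl : LocallyIntegrableOn D (Ioi 0) := hU.sub hPl
  have hD0 : ∀ η : ℝ → ℝ, ContDiff ℝ (⊤ : ℕ∞) η → HasCompactSupport η → tsupport η ⊆ Ioi 0 →
      ∫ r in Ioi (0:ℝ), D r * deriv η r = 0 := by
    intro η hη hc hs
    obtain ⟨a, b, ha, hab, hηa, hηb⟩ := supp_ab hc hs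
    have hdc : Continuous (deriv η) := hη.continuous_deriv (by simp)
    obtain ⟨a', b', ha', hab', hηa', hηb'⟩ := supp_ab hc.deriv
      (((closure_mono support_deriv_subset).trans (isClosed_tsupport η).closure_eq.subset).trans hs)
    have e1 : ∫ r in Ioi (0:ℝ), P r * deriv η r = - ∫ r in Ioi (0:ℝ), h r * η r := by
      set A := min a a'
      set B := max b b'
      have hA : 0 < A := lt_min ha ha'
      have hAB : A ≤ B := (min_le_left _ _).trans (hab.le.trans (le_max_left _ _))
      rw [set_to_interval hA hAB (fun r hr => by simp [hηa' r (hr.trans (min_le_right _ _))])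
        (fun r hr => by simp [hηb' r ((le_max_right _ _).trans hr)]),
        set_to_interval hA hAB (fun r hr => by simp [hηa r (hr.trans (min_le_left _ _))])
        (fun r hr => by simp [hηb r ((le_max_left _ _).trans hr)]),
        intervalIntegral.integral_mul_deriv_eq_deriv_mul (u := P) (u' := h) (v := η)]
      · rw [hηa A (min_le_left _ _), hηb B (le_max_left _ _)]; simp
      · intro x hx
        rw [uIcc_of_le hAB] at hx
        exact hPd x (hA.trans_le hx.1)
      · intro x _
        exact (hη.differentiable (by simp) x).hasDerivAt
      · exact hii _ _ hA (hA.trans_le hAB)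
      · exact hdc.intervalIntegrable _ _
    simp only [hDdef, sub_mul]
    rw [integral_sub (test_int hU hdc ha' hηa' hηb') (test_int hPl hdc ha' hηa' hηb'),
      hw η hη hc hs, e1, sub_self]
  let bmp : ContDiffBump (2:ℝ) := ⟨1/2, 1, by norm_num, by norm_num⟩
  set ζ0 : ℝ → ℝ := bmp.normed volume with hζ0
  have z1 : ContDiff ℝ (⊤ : ℕ∞) ζ0 := bmp.contDiff_normed
  have z2 : HasCompactSupport ζ0 := bmp.hasCompactSupport_normed
  have z3 : tsupport ζ0 ⊆ Ioi 0 := by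
    rw [hζ0, bmp.tsupport_normed_eq]
    intro r hr
    rw [Metric.mem_closedBall, Real.dist_eq, abs_le] at hr
    have : -1 ≤ r - 2 := hr.1
    simp only [mem_Ioi]; linarith
  have z4 : ∫ r, ζ0 r = 1 := bmp.integral_normed
  obtain ⟨a0, b0, ha0, hab0, hza0, hzb0⟩ := supp_ab z2 z3
  set c := ∫ r in Ioi (0:ℝ), D r * ζ0 r with hc
  have fin : ∀ᵐ r : ℝ, r ∈ Ioi (0:ℝ) → D r - c = 0 := by
    refine isOpen_Ioi.ae_eq_zero_of_integral_contDiff_smul_eq_zero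
      (hDl.sub (locallyIntegrableOn_const c)) ?_
    intro ζ y1 y2 y3
    obtain ⟨a1, b1, ha1, hab1, hya1, hyb1⟩ := supp_ab y2 y3
    set I := ∫ r, ζ r with hI
    set A := min a0 a1
    set B := max b0 b1
    have hA : 0 < A := lt_min ha0 ha1
    have hAB : A ≤ B := (min_le_left _ _).trans (hab0.le.trans (le_max_left _ _))
    set θ : ℝ → ℝ := fun r => ζ r - I * ζ0 r with hθ
    have hθs : ContDiff ℝ (⊤ : ℕ∞) θ := y1.sub (contDiff_const.mul z1)
    have hθA : ∀ r, r ≤ A → θ r = 0 := fun r hr => by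
      simp [hθ, hza0 r (hr.trans (min_le_left _ _)), hya1 r (hr.trans (min_le_right _ _))]
    have hθB : ∀ r, B ≤ r → θ r = 0 := fun r hr => by
      simp [hθ, hzb0 r ((le_max_left _ _).trans hr), hyb1 r ((le_max_right _ _).trans hr)]
    have i0 : Integrable ζ0 := z1.continuous.integrable_of_hasCompactSupport z2
    have i1 : Integrable ζ := y1.continuous.integrable_of_hasCompactSupport y2
    have hθ0 : ∫ r in A..B, θ r = 0 := by
      have : ∫ r, θ r = 0 := by
        simp only [hθ]
        rw [integral_sub i1 (i0.const_mul I), integral_const_mul, z4]; simp [hI]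
      rw [← this, ← set_to_interval hA hAB hθA hθB]
      refine setIntegral_eq_integral_of_forall_compl_eq_zero fun r hr => hθA r ?_
      simp only [mem_Ioi, not_lt] at hr
      linarith
    set η : ℝ → ℝ := fun r => ∫ s in A..r, θ s with hη
    have hηd : ∀ t, HasDerivAt η (θ t) t := fun t =>
      intervalIntegral.integral_hasDerivAt_right (hθs.continuous.intervalIntegrable _ _)
        (hθs.continuous.stronglyMeasurableAtFilter _ _) hθs.continuous.continuousAt
    have hηs : ContDiff ℝ (⊤ : ℕ∞) η := by
      rw [contDiff_infty_iff_deriv]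
      refine ⟨fun t => (hηd t).differentiableAt, ?_⟩
      rw [show deriv η = θ from funext fun t => (hηd t).deriv]
      exact hθs
    have hsub : Function.support η ⊆ Icc A B := by
      intro r hr
      by_contra hcr
      apply hr
      simp only [mem_Icc, not_and_or, not_le] at hcr
      rcases hcr with h | h
      · simp only [hη]
        rw [intervalIntegral.integral_congr (g := fun _ => 0), intervalIntegral.integral_zero]
        intro s hs
        rw [uIcc_of_ge h.le] at hs
        exact hθA s hs.2
      · simp only [hη]
        rw [← intervalIntegral.integral_add_adjacent_intervals (b := B)
          (hθs.continuous.intervalIntegrable _ _) (hθs.continuous.intervalIntegrable _ _), hθ0,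
          zero_add, intervalIntegral.integral_congr (g := fun _ => 0),
          intervalIntegral.integral_zero]
        intro s hs
        rw [uIcc_of_le h.le] at hs
        exact hθB s hs.1
    have hD1 := hD0 η hηs (HasCompactSupport.of_support_subset_isCompact isCompact_Icc hsub)
      ((closure_minimal hsub isClosed_Icc).trans fun r hr => hA.trans_le hr.1)
    rw [show deriv η = θ from funext fun t => (hηd t).deriv] at hD1
    have j1 := test_int hDl y1.continuous ha1 hya1 hyb1
    have j0 := test_int hDl z1.continuous ha0 hza0 hzb0
    have e2 : ∫ r in Ioi (0:ℝ), D r * θ r = (∫ r in Ioi (0:ℝ), D r * ζ r) - I * c := by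
      rw [hc, ← integral_const_mul, ← integral_sub j1 (j0.const_mul I)]
      congr 1; ext r; simp only [hθ]; ring
    have e3 : ∫ r, ζ r • (D r - c) = ∫ r in Ioi (0:ℝ), ζ r • (D r - c) := by
      refine (setIntegral_eq_integral_of_forall_compl_eq_zero fun r hr => ?_).symm
      simp only [mem_Ioi, not_lt] at hr
      simp [hya1 r (by linarith)]
    have e4 : I = ∫ r in Ioi (0:ℝ), ζ r := by
      refine (setIntegral_eq_integral_of_forall_compl_eq_zero fun r hr => ?_).symm
      simp only [mem_Ioi, not_lt] at hr
      simp [hya1 r (by linarith)]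
    rw [e3]
    have e5 : ∫ r in Ioi (0:ℝ), ζ r • (D r - c) = (∫ r in Ioi (0:ℝ), D r * ζ r) - c * I := by
      rw [e4, ← integral_const_mul, ← integral_sub j1 (i1.integrableOn.const_mul c)]
      congr 1; ext r; simp only [smul_eq_mul]; ring
    rw [e5, mul_comm c I, ← e2, hD1]
  refine ⟨fun r => P r + c, fun r hr => (hPd r hr).add_const c, ?_⟩
  filter_upwards [fin] with r hr h0
  have := hr h0
  simp only [hDdef] at this
  linarith

lemma final1D {F h : ℝ → ℝ} {R2 p q C2 J0 : ℝ} (hR2 : 0 < R2)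
    (hF : ∀ r, 0 < r → HasDerivAt F (h r) r) (hh : ContinuousOn h (Ioi 0))
    (hb : ∀ r, 0 < r → h r ^ 2 ≤ C2 * r ^ q) (hC2 : 0 ≤ C2) (hp : -1 < p) (hpq : 0 < p - q - 1)
    (hi : IntegrableOn (fun s => s ^ p * F s ^ 2) (Ioi R2))
    (hJ : ∫ s in Ioi R2, s ^ p * F s ^ 2 ≤ J0) {r δ : ℝ} (hr : R2 < r) (hδ : 0 < δ) :
    F r ^ 2 ≤ δ * J0 + δ⁻¹ * (C2 * (r ^ (-(p - q - 1)) / (p - q - 1))) := by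
  have hr0 : 0 < r := hR2.trans hr
  have hqi : IntegrableOn (fun s : ℝ => s ^ (q - p)) (Ioi r) :=
    integrableOn_Ioi_rpow_of_lt (by linarith) hr0
  have hqv : ∫ s in Ioi r, s ^ (q - p) = r ^ (-(p - q - 1)) / (p - q - 1) := by
    rw [integral_Ioi_rpow_of_lt (by linarith) hr0, show q - p + 1 = -(p - q - 1) by ring,
      neg_div_neg_eq]
  have hir : IntegrableOn (fun s => s ^ p * F s ^ 2) (Ioi r) :=
    hi.mono_set (Ioi_subset_Ioi hr.le)
  set T : ℝ → ℝ := fun s => δ * (s ^ p * F s ^ 2) + δ⁻¹ * (C2 * s ^ (q - p)) with hT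
  have hTi : IntegrableOn T (Ioi r) := (hir.const_mul δ).add ((hqi.const_mul C2).const_mul δ⁻¹)
  have hT0 : ∀ s ∈ Ioi r, 0 ≤ T s := by
    intro s hs
    have : 0 < s := hr0.trans hs
    simp only [hT]; positivity
  have hTv : ∫ s in Ioi r, T s ≤ δ * J0 + δ⁻¹ * (C2 * (r ^ (-(p - q - 1)) / (p - q - 1))) := by
    simp only [hT]
    rw [integral_add (hir.const_mul δ) ((hqi.const_mul C2).const_mul δ⁻¹), integral_const_mul,
      integral_const_mul, integral_const_mul, hqv]
    have : ∫ s in Ioi r, s ^ p * F s ^ 2 ≤ J0 := by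
      refine le_trans (setIntegral_mono_set hi ?_ (Ioi_subset_Ioi hr.le).eventuallyLE) hJ
      rw [Filter.EventuallyLE, ae_restrict_iff' measurableSet_Ioi]
      refine Eventually.of_forall fun s hs => ?_
      have : 0 < s := hR2.trans hs
      simp only [Pi.zero_apply]; positivity
    gcongr
  by_contra hcon
  rw [not_le] at hcon
  set A := δ * J0 + δ⁻¹ * (C2 * (r ^ (-(p - q - 1)) / (p - q - 1))) with hA
  have hlow : ∀ b, r < b → F r ^ 2 - A ≤ F b ^ 2 := by
    intro b hrb
    have hpos : ∀ x ∈ uIcc r b, 0 < x := fun x hx => by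
      rw [uIcc_of_le hrb.le] at hx; exact hr0.trans_le hx.1
    have hFc : ContinuousOn F (uIcc r b) := fun x hx =>
      (hF x (hpos x hx)).continuousAt.continuousWithinAt
    have hii : IntervalIntegrable (fun s => 2 * F s * h s) volume r b :=
      ((continuousOn_const.mul hFc).mul (hh.mono fun x hx => hpos x hx)).intervalIntegrable
    have e := intervalIntegral.integral_eq_sub_of_hasDerivAt (f := fun s => F s ^ 2)
      (f' := fun s => 2 * F s * h s) (a := r) (b := b)
      (fun x hx => by
        have h7 := (hF x (hpos x hx)).fun_pow 2
        exact h7.congr_deriv (by norm_num)) hii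
    have e2 : ∫ s in r..b, -(2 * F s * h s) ≤ ∫ s in Ioi r, T s := by
      rw [intervalIntegral.integral_of_le hrb.le]
      refine (setIntegral_mono_on (f := fun s => -(2 * F s * h s)) (g := T)
        ((intervalIntegrable_iff_integrableOn_Ioc_of_le hrb.le).1 hii.neg)
        (hTi.mono_set Ioc_subset_Ioi_self) measurableSet_Ioc ?_).trans ?_
      · intro s hs
        have hs0 : 0 < s := hr0.trans hs.1
        have h1 := hb s hs0
        have hsp : 0 < s ^ p := Real.rpow_pos_of_pos hs0 p
        have h2 : C2 * s ^ (q - p) = (s ^ p)⁻¹ * (C2 * s ^ q) := by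
          rw [Real.rpow_sub hs0]; field_simp
        simp only [hT]
        rw [h2]
        have h3 : (s ^ p)⁻¹ * h s ^ 2 ≤ (s ^ p)⁻¹ * (C2 * s ^ q) := by gcongr
        have h4 : δ⁻¹ * ((s ^ p)⁻¹ * h s ^ 2) ≤ δ⁻¹ * ((s ^ p)⁻¹ * (C2 * s ^ q)) := by gcongr
        have h5 : 0 ≤ (δ * s ^ p)⁻¹ * (δ * s ^ p * F s + h s) ^ 2 := by positivity
        have h6 : (δ * s ^ p)⁻¹ * (δ * s ^ p * F s + h s) ^ 2 =
          δ * (s ^ p * F s ^ 2) + 2 * F s * h s + δ⁻¹ * ((s ^ p)⁻¹ * h s ^ 2) := by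
          field_simp
          ring
        linarith
      · refine setIntegral_mono_set hTi ?_ Ioc_subset_Ioi_self.eventuallyLE
        rw [Filter.EventuallyLE, ae_restrict_iff' measurableSet_Ioi]
        exact Eventually.of_forall hT0
    rw [intervalIntegral.integral_neg, e] at e2
    linarith
  have hε : 0 < F r ^ 2 - A := by linarith
  have hbad : IntegrableOn (fun s : ℝ => s ^ p) (Ioi r) := by
    refine Integrable.mono' (hir.const_mul (F r ^ 2 - A)⁻¹) ?_ ?_
    · exact (ContinuousOn.rpow_const continuousOn_id fun x hx =>
        Or.inl (hr0.trans hx).ne').aestronglyMeasurable measurableSet_Ioi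
    · rw [ae_restrict_iff' measurableSet_Ioi]
      refine Eventually.of_forall fun s hs => ?_
      have hs0 : 0 < s := hr0.trans hs
      have hsp : 0 < s ^ p := Real.rpow_pos_of_pos hs0 p
      rw [Real.norm_of_nonneg hsp.le, inv_mul_eq_div, le_div_iff₀ hε]
      exact mul_le_mul_of_nonneg_left (hlow s hs) hsp.le
  rw [integrableOn_Ioi_rpow_iff hr0] at hbad
  linarith

lemma ballInt_sq {N : ℕ} (hN : 5 ≤ N) {w : E N → ℝ} (hw : MemLp w 2 volume) {r : ℝ} (hr : 0 < r) :
    ballInt w r ^ 2 ≤ (sigmaN N / N * r ^ N) * ∫ x, w x ^ 2 := by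
  set B := Metric.ball (0 : E N) r with hB
  have hv : volume.real B = sigmaN N / N * r ^ N := by
    have := Measure.addHaar_ball_of_pos (volume : Measure (E N)) 0 hr
    rw [Measure.real, hB, this, ENNReal.toReal_mul, ENNReal.toReal_ofReal (by positivity), sigmaN]
    have : (N:ℝ) ≠ 0 := by positivity
    simp only [finrank_euclideanSpace, Fintype.card_fin]
    field_simp
  have hσ := sigmaN_pos hN
  have hv0 : 0 < volume.real B := by rw [hv]; positivity
  have hfin : IsFiniteMeasure (volume.restrict B) :=
    ⟨by simpa using measure_ball_lt_top⟩
  have hi2 : Integrable (fun x => w x ^ 2) := hw.integrable_sq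
  have hi1 : IntegrableOn w B := (hw.restrict B).integrable (by norm_num)
  set c := ballInt w r / volume.real B with hc
  have h0 : 0 ≤ ∫ x in B, (w x - c) ^ 2 := integral_nonneg fun x => sq_nonneg _
  have h1 : ∫ x in B, (w x - c) ^ 2 = (∫ x in B, w x ^ 2) - 2 * c * ballInt w r
      + c ^ 2 * volume.real B := by
    have e : (fun x => (w x - c) ^ 2) = fun x => (w x ^ 2 - 2 * c * w x) + c ^ 2 := by
      ext x; ring
    have i3 : Integrable (fun x => w x ^ 2 - 2 * c * w x) (volume.restrict B) :=
      hi2.integrableOn.sub (hi1.const_mul _)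
    rw [e, integral_add i3 (integrable_const _),
      integral_sub hi2.integrableOn (hi1.const_mul _), integral_const_mul]
    simp [ballInt, mul_comm, hB]
  have h2 : ∫ x in B, w x ^ 2 ≤ ∫ x, w x ^ 2 :=
    setIntegral_le_integral hi2 (Eventually.of_forall fun x => sq_nonneg _)
  have h3 : ballInt w r ^ 2 / volume.real B ≤ ∫ x in B, w x ^ 2 := by
    have : 2 * c * ballInt w r - c ^ 2 * volume.real B = ballInt w r ^ 2 / volume.real B := by
      rw [hc]; field_simp; ring
    linarith
  rw [← hv, mul_comm, ← div_le_iff₀ hv0]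
  exact h3.trans h2

lemma radial_profile {N : ℕ} (hN : 5 ≤ N) {u : E N → ℝ} (hu : IsRadial u) :
    ∃ U : ℝ → ℝ, ∀ x, u x = U ‖x‖ := by
  refine ⟨fun r => u (EuclideanSpace.single (⟨0, by omega⟩ : Fin N) r), fun x => hu _ _ ?_⟩
  simp

lemma profile_locInt {N : ℕ} (hN : 5 ≤ N) {u : E N → ℝ} {U : ℝ → ℝ} (hU : ∀ x, u x = U ‖x‖)
    (hl : LocallyIntegrable u) : LocallyIntegrableOn U (Ioi 0) := by
  rw [locallyIntegrableOn_iff isOpen_Ioi.isLocallyClosed]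
  intro K hK hKc
  have : NeZero N := ⟨by omega⟩
  obtain ⟨b, hb⟩ := hKc.bddAbove
  have h1 : IntegrableOn (fun x : E N => U ‖x‖) (Metric.ball 0 (b + 1)) := by
    have : IntegrableOn u (Metric.ball 0 (b + 1)) :=
      (hl.integrableOn_isCompact (isCompact_closedBall _ _)).mono_set Metric.ball_subset_closedBall
    exact this.congr_fun (fun x _ => hU x) measurableSet_ball
  have h2 := (integrableOn_fun_norm_addHaar (volume : Measure (E N))).1 h1
  simp only [finrank_euclideanSpace, Fintype.card_fin, smul_eq_mul] at h2
  have h3 : IntegrableOn (fun y => y ^ (N - 1) * U y) K :=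
    h2.mono_set fun y hy => ⟨hK hy, by linarith [hb hy]⟩
  have h4 : IntegrableOn (fun y => (y ^ (N - 1) * U y) * (y ^ (N - 1))⁻¹) K := by
    refine h3.mul_continuousOn ?_ hKc
    exact ContinuousOn.inv₀ (by fun_prop) fun y hy => (pow_pos (hK hy) _).ne'
  refine h4.congr_fun (fun y hy => ?_) hKc.measurableSet
  have : (0:ℝ) < y := hK hy
  simp only
  field_simp

lemma four_pow_bound {F σ lam n β H r : ℝ} (hσ : 0 < σ) (hl : 0 < lam) (hn : 0 < n) (hβ : 0 < β)
    (hH : 0 ≤ H) (hr : 0 < r)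
    (hF : ∀ δ, 0 < δ → F ^ 2 ≤ δ * (H / (lam * σ)) + δ⁻¹ * (H / (n * σ) * (r ^ (-β) / β))) :
    |F| ≤ (1 / Real.sqrt σ) * (8 / (n * β)) ^ ((1:ℝ)/4) * lam ^ (-(1:ℝ)/4) *
      H ^ (1/2 : ℝ) / r ^ (β / 4) := by
  have hrb : 0 < r ^ (-β) := Real.rpow_pos_of_pos hr _
  set Q := r ^ (-β) / (n * β) with hQ
  have hQ0 : 0 < Q := by positivity
  set δ := Real.sqrt (lam * Q) with hδ
  have hδ0 : 0 < δ := Real.sqrt_pos.2 (by positivity)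
  have hδ2 : δ ^ 2 = lam * Q := Real.sq_sqrt (by positivity)
  have h1 := hF δ hδ0
  have h2 : δ * (H / (lam * σ)) + δ⁻¹ * (H / (n * σ) * (r ^ (-β) / β)) = 2 * δ * H / (lam * σ) := by
    have : H / (n * σ) * (r ^ (-β) / β) = H / σ * Q := by rw [hQ]; field_simp
    rw [this]
    have : Q = δ ^ 2 / lam := by rw [hδ2]; field_simp
    rw [this]; field_simp; ring
  rw [h2] at h1
  have h3 : |F| ^ 4 ≤ (2 * δ * H / (lam * σ)) ^ 2 := by
    have : |F| ^ 4 = (F ^ 2) ^ 2 := by rw [← sq_abs F]; ring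
    rw [this]
    exact pow_le_pow_left₀ (sq_nonneg _) h1 2
  have h4 : (2 * δ * H / (lam * σ)) ^ 2 = 4 * Q * H ^ 2 / (lam * σ ^ 2) := by
    rw [div_pow, mul_pow, mul_pow, hδ2]; field_simp; ring
  rw [h4] at h3
  have rp : ∀ (x : ℝ) (y : ℝ), 0 ≤ x → (x ^ y) ^ 4 = x ^ (y * 4) := fun x y hx => by
    rw [← Real.rpow_natCast, ← Real.rpow_mul hx]; norm_num
  have h5 : ((1 / Real.sqrt σ) * (8 / (n * β)) ^ ((1:ℝ)/4) * lam ^ (-(1:ℝ)/4) *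
      H ^ (1/2 : ℝ) / r ^ (β / 4)) ^ 4 = 8 * Q * H ^ 2 / (lam * σ ^ 2) := by
    have e1 : (Real.sqrt σ) ^ 4 = σ ^ 2 := by
      rw [show (4:ℕ) = 2 * 2 by norm_num, pow_mul, Real.sq_sqrt hσ.le]
    rw [div_pow, mul_pow, mul_pow, mul_pow, div_pow, e1, rp _ _ (by positivity), rp _ _ hl.le,
      rp _ _ hH, rp _ _ hr.le, show (1:ℝ)/4*4 = 1 by norm_num, show -(1:ℝ)/4*4 = -1 by norm_num,
      show (1/2:ℝ)*4 = (2:ℕ) by norm_num, show β/4*4 = β by ring, Real.rpow_one,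
      Real.rpow_neg_one, Real.rpow_natCast, hQ, Real.rpow_neg hr.le]
    have : 0 < r ^ β := Real.rpow_pos_of_pos hr _
    field_simp
  refine le_of_pow_le_pow_left₀ (n := 4) (by norm_num) (by positivity) ?_
  rw [h5]
  refine h3.trans ?_
  gcongr
  norm_num

lemma h_bound {N : ℕ} (hN : 5 ≤ N) {w : E N → ℝ} (hw : MemLp w 2 volume) {H : ℝ}
    (hH : ∫ x, w x ^ 2 ≤ H) {r : ℝ} (hr : 0 < r) :
    ((sigmaN N)⁻¹ * (r^(N-1))⁻¹ * ballInt w r) ^ 2 ≤ H / (N * sigmaN N) * r ^ ((2:ℝ) - N) := by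
  have hσ := sigmaN_pos hN
  have hN0 : (0:ℝ) < N := by positivity
  have h1 := ballInt_sq hN hw hr
  have h2 : r ^ ((2:ℝ) - N) = r ^ 2 / r ^ N := by
    rw [Real.rpow_sub hr, Real.rpow_natCast]; norm_cast
  have h3 : r ^ N = r ^ (N - 1) * r := by
    rw [← pow_succ]; congr 1; omega
  have hp : 0 < r ^ (N - 1) := pow_pos hr _
  calc ((sigmaN N)⁻¹ * (r^(N-1))⁻¹ * ballInt w r) ^ 2
      = ((sigmaN N)⁻¹ * (r^(N-1))⁻¹) ^ 2 * ballInt w r ^ 2 := by ring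
    _ ≤ ((sigmaN N)⁻¹ * (r^(N-1))⁻¹) ^ 2 * ((sigmaN N / N * r ^ N) * H) := by
        gcongr
        exact h1.trans (by gcongr)
    _ = H / (N * sigmaN N) * r ^ ((2:ℝ) - N) := by
        rw [h2, h3]; field_simp

lemma weight_bound {N : ℕ} (hN : 5 ≤ N) {V : ℝ → ℝ≥0∞} {R2 γ : ℝ} (hR2 : 0 < R2) {lam : ℝ}
    (hl : 0 < lam)
    (hlam : ∀ᵐ r : ℝ, R2 < r → ENNReal.ofReal lam ≤ ENNReal.ofReal r ^ γ * V r)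
    {u : E N → ℝ} {U : ℝ → ℝ} (hU : ∀ x, u x = U ‖x‖) (hum : AEStronglyMeasurable u volume)
    (hfin : (∫⁻ x : E N, V ‖x‖ * ENNReal.ofReal ((u x) ^ 2)) < ⊤) :
    IntegrableOn (fun s => s ^ ((N:ℝ) - 1 - γ) * U s ^ 2) (Ioi R2) ∧
    ∫ s in Ioi R2, s ^ ((N:ℝ) - 1 - γ) * U s ^ 2 ≤
      (∫⁻ x : E N, V ‖x‖ * ENNReal.ofReal ((u x) ^ 2)).toReal / (lam * sigmaN N) := by
  have hσ := sigmaN_pos hN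
  set f : ℝ → ℝ := (Ioi R2).indicator fun r => r ^ (-γ) * U r ^ 2 with hf
  have hf0 : ∀ r, 0 ≤ f r := fun r => indicator_nonneg (fun s hs => by
    have : 0 < s := hR2.trans hs
    positivity) r
  have hfm : AEStronglyMeasurable (fun x : E N => f ‖x‖) volume := by
    have e : (fun x : E N => f ‖x‖) =
        {x : E N | R2 < ‖x‖}.indicator (fun x => ‖x‖ ^ (-γ) * u x ^ 2) := by
      ext x
      simp only [hf, indicator_apply, mem_Ioi, mem_ofPred_eq, hU]
    rw [e]
    refine AEStronglyMeasurable.indicator ?_ (measurableSet_lt measurable_const measurable_norm)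
    exact ((measurable_norm.pow_const _).aestronglyMeasurable).mul (hum.pow 2)
  have hle : ∀ᵐ x : E N, ENNReal.ofReal (lam * f ‖x‖) ≤ V ‖x‖ * ENNReal.ofReal ((u x) ^ 2) := by
    have := ae_norm hN (fun r => R2 < r → ENNReal.ofReal lam ≤ ENNReal.ofReal r ^ γ * V r)
      (hlam.mono fun r h _ => h)
    filter_upwards [this] with x hx
    by_cases hxR : R2 < ‖x‖
    · have hx0 : 0 < ‖x‖ := hR2.trans hxR
      have hxg : 0 < ‖x‖ ^ γ := Real.rpow_pos_of_pos hx0 _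
      have h1 := hx hxR
      rw [ENNReal.ofReal_rpow_of_pos hx0] at h1
      have e : lam * f ‖x‖ = lam * (‖x‖ ^ γ)⁻¹ * (u x) ^ 2 := by
        simp only [hf, indicator_apply, mem_Ioi, hxR, if_true, hU]
        rw [Real.rpow_neg hx0.le]; ring
      rw [e, ENNReal.ofReal_mul (by positivity)]
      gcongr
      rw [mul_comm, ENNReal.ofReal_mul (by positivity)]
      calc ENNReal.ofReal (‖x‖ ^ γ)⁻¹ * ENNReal.ofReal lam
          ≤ ENNReal.ofReal (‖x‖ ^ γ)⁻¹ * (ENNReal.ofReal (‖x‖ ^ γ) * V ‖x‖) := by gcongr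
        _ = V ‖x‖ := by
          rw [← mul_assoc, ← ENNReal.ofReal_mul (by positivity), inv_mul_cancel₀ hxg.ne']
          simp
    · have : f ‖x‖ = 0 := by simp [hf, hxR]
      simp [this]
  have hll := lintegral_mono_ae hle
  have hli : Integrable (fun x : E N => lam * f ‖x‖) := by
    refine ⟨hfm.const_mul _, ?_⟩
    rw [hasFiniteIntegral_iff_ofReal (Eventually.of_forall fun x => mul_nonneg hl.le (hf0 _))]
    exact hll.trans_lt hfin
  have hfi : Integrable (fun x : E N => f ‖x‖) := by
    have := hli.const_mul lam⁻¹
    refine this.congr (Eventually.of_forall fun x => ?_)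
    simp only
    field_simp
  have hval : lam * ∫ x : E N, f ‖x‖ ≤
      (∫⁻ x : E N, V ‖x‖ * ENNReal.ofReal ((u x) ^ 2)).toReal := by
    rw [← integral_const_mul, integral_eq_lintegral_of_nonneg_ae
      (Eventually.of_forall fun x => mul_nonneg hl.le (hf0 _)) hli.1]
    exact ENNReal.toReal_mono hfin.ne hll
  have e1 : (fun y => y ^ (N-1) * f y) =
      (Ioi R2).indicator fun s => s ^ ((N:ℝ) - 1 - γ) * U s ^ 2 := by
    ext y
    by_cases hy : R2 < y
    · have hy0 : 0 < y := hR2.trans hy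
      simp only [hf, indicator_apply, mem_Ioi, hy, if_true]
      rw [← mul_assoc, ← Real.rpow_natCast, ← Real.rpow_add hy0]
      congr 2
      rw [Nat.cast_sub (by omega)]; push_cast; ring
    · simp [hf, hy]
  have hsub : Ioi R2 ∩ Ioi (0:ℝ) = Ioi R2 := inter_eq_left.2 (Ioi_subset_Ioi hR2.le)
  have h1 := (sig_integrable hN f).1 hfi
  have h2 := sig_polar hN f
  rw [e1] at h1
  simp_rw [fun y => congrFun e1 y] at h2
  rw [IntegrableOn, integrable_indicator_iff measurableSet_Ioi, IntegrableOn,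
    Measure.restrict_restrict measurableSet_Ioi, hsub] at h1
  rw [integral_indicator measurableSet_Ioi, Measure.restrict_restrict measurableSet_Ioi, hsub] at h2
  refine ⟨h1, ?_⟩
  rw [le_div_iff₀ (by positivity)]
  rw [h2] at hval
  linarith

/-- Proposition 5.2: if `λ_∞ = ess inf_{r>R₂} r^{γ_∞}V(r) > 0` with
`γ_∞ ≤ 14/3`, then every `u ∈ H²_{V,r}` satisfies
`|u(x)| ≤ c_∞ λ_∞^{-1/4} ‖u‖ |x|^{-(2(N-2)-γ_∞)/4}` a.e. in `{|x| > R₂}`, where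
`c_∞ = σ_N^{-1/2}(8/(N(2(N-2)-γ_∞)))^{1/4}`. -/
theorem stmt11 (N : ℕ) (hN : 5 ≤ N) (V : ℝ → ℝ≥0∞) (hVmeas : Measurable V)
    (R2 : ℝ) (hR2 : 0 < R2) (γ : ℝ) (hγ : γ ≤ 14/3)
    (hVfin : ∀ᵐ r ∂(volume.restrict (Set.Ioi R2)), V r < ⊤)
    (hinf : 0 < essInf (fun r : ℝ => ENNReal.ofReal r ^ γ * V r)
      (volume.restrict (Set.Ioi R2)))
    (u w : E N → ℝ) (hu : MemH2Vr V u w) :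
    ∀ᵐ x : E N ∂volume, R2 < ‖x‖ →
      |u x| ≤ (1 / Real.sqrt (sigmaN N)) * (8 / (N * (2*((N:ℝ)-2) - γ))) ^ ((1:ℝ)/4) *
        (essInf (fun r : ℝ => ENNReal.ofReal r ^ γ * V r)
          (volume.restrict (Set.Ioi R2))).toReal ^ (-(1:ℝ)/4) *
        H2norm V u w / ‖x‖ ^ ((2*((N:ℝ)-2) - γ)/4) := by
  obtain ⟨⟨hD, hVint⟩, hrad⟩ := hu
  have hσ := sigmaN_pos hN
  have hN5 : (5:ℝ) ≤ N := by exact_mod_cast hN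
  have hN0 : (0:ℝ) < N := by linarith
  have hβ : 0 < 2 * ((N:ℝ) - 2) - γ := by linarith
  obtain ⟨U, hU⟩ := radial_profile hN hrad
  have hw := hD.2.1
  have hl := hD.1.locallyIntegrable (twoSS_one_le hN)
  have hUl := profile_locInt hN hU hl
  set h : ℝ → ℝ := fun r => (sigmaN N)⁻¹ * (r ^ (N - 1))⁻¹ * ballInt w r with hh
  have hhc : ContinuousOn h (Ioi 0) := by
    refine (continuousOn_const.mul (ContinuousOn.inv₀ (by fun_prop) fun y hy => ?_)).mul
      (ballInt_cont hN hw).continuousOn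
    exact (pow_pos hy _).ne'
  obtain ⟨F, hF, hUF⟩ := dbr hUl hhc fun η h1 h2 h3 => weak_deriv hN hD U hU h1 h2 h3
  set lam := essInf (fun r : ℝ => ENNReal.ofReal r ^ γ * V r) (volume.restrict (Set.Ioi R2))
    with hlamdef
  have hae : ∀ᵐ r ∂(volume.restrict (Set.Ioi R2)), lam ≤ ENNReal.ofReal r ^ γ * V r :=
    ae_essInf_le
  have hne : (volume.restrict (Set.Ioi R2)) ≠ 0 := by
    rw [Ne, Measure.restrict_eq_zero]; simp
  have hlt : lam < ⊤ := by
    have : (ae (volume.restrict (Set.Ioi R2))).NeBot := ae_neBot.2 hne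
    obtain ⟨r, ⟨h1, h2⟩, h3⟩ := ((hae.and hVfin).and (ae_restrict_mem measurableSet_Ioi)).exists
    have h0 : 0 < r := hR2.trans h3
    refine h1.trans_lt (ENNReal.mul_lt_top ?_ h2)
    rw [ENNReal.ofReal_rpow_of_pos h0]
    exact ENNReal.ofReal_lt_top
  have hl0 : 0 < lam.toReal := ENNReal.toReal_pos hinf.ne' hlt.ne
  have hlam : ∀ᵐ r : ℝ, R2 < r → ENNReal.ofReal lam.toReal ≤ ENNReal.ofReal r ^ γ * V r := by
    rw [ENNReal.ofReal_toReal hlt.ne]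
    exact (ae_restrict_iff' measurableSet_Ioi).1 hae
  obtain ⟨hi, hJ⟩ := weight_bound hN hR2 hl0 hlam hU hD.1.1 hVint
  have hwi : Integrable (fun x => w x ^ 2) := hw.integrable_sq
  have hA : ∫ x, w x ^ 2 = (∫⁻ x : E N, ENNReal.ofReal ((w x) ^ 2)).toReal :=
    integral_eq_lintegral_of_nonneg_ae (Eventually.of_forall fun x => sq_nonneg _) hwi.1
  have hAfin : (∫⁻ x : E N, ENNReal.ofReal ((w x) ^ 2)) < ⊤ :=
    (hasFiniteIntegral_iff_ofReal (Eventually.of_forall fun x => sq_nonneg _)).1 hwi.2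
  set H := ((∫⁻ x : E N, ENNReal.ofReal ((w x) ^ 2)) +
    ∫⁻ x : E N, V ‖x‖ * ENNReal.ofReal ((u x) ^ 2)).toReal with hHdef
  have hHadd : H = (∫⁻ x : E N, ENNReal.ofReal ((w x) ^ 2)).toReal +
      (∫⁻ x : E N, V ‖x‖ * ENNReal.ofReal ((u x) ^ 2)).toReal :=
    ENNReal.toReal_add hAfin.ne hVint.ne
  have hH0 : 0 ≤ H := ENNReal.toReal_nonneg
  have hHA : ∫ x, w x ^ 2 ≤ H := by
    rw [hA, hHadd]; exact le_add_of_nonneg_right ENNReal.toReal_nonneg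
  have hHB : (∫⁻ x : E N, V ‖x‖ * ENNReal.ofReal ((u x) ^ 2)).toReal ≤ H := by
    rw [hHadd]; exact le_add_of_nonneg_left ENNReal.toReal_nonneg
  have hcongr : (fun s => s ^ ((N:ℝ) - 1 - γ) * U s ^ 2) =ᵐ[volume.restrict (Ioi R2)]
      fun s => s ^ ((N:ℝ) - 1 - γ) * F s ^ 2 := by
    rw [Filter.EventuallyEq, ae_restrict_iff' measurableSet_Ioi]
    filter_upwards [hUF] with s hs hs2
    rw [hs (hR2.trans hs2)]
  have hiF : IntegrableOn (fun s => s ^ ((N:ℝ) - 1 - γ) * F s ^ 2) (Ioi R2) := hi.congr hcongr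
  have hJF : ∫ s in Ioi R2, s ^ ((N:ℝ) - 1 - γ) * F s ^ 2 ≤ H / (lam.toReal * sigmaN N) := by
    rw [← integral_congr_ae hcongr]
    exact hJ.trans (by gcongr)
  have key : ∀ r, R2 < r → |F r| ≤ (1 / Real.sqrt (sigmaN N)) *
      (8 / (N * (2*((N:ℝ)-2) - γ))) ^ ((1:ℝ)/4) * lam.toReal ^ (-(1:ℝ)/4) *
      H ^ (1/2 : ℝ) / r ^ ((2*((N:ℝ)-2) - γ)/4) := by
    intro r hr
    refine four_pow_bound hσ hl0 hN0 hβ hH0 (hR2.trans hr) fun δ hδ => ?_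
    have := final1D (q := (2:ℝ) - N) (p := (N:ℝ) - 1 - γ) (C2 := H / (N * sigmaN N)) hR2 hF hhc
      (fun r hr => h_bound hN hw hHA hr) (by positivity) (by linarith) (by linarith) hiF hJF hr hδ
    rwa [show (N:ℝ) - 1 - γ - (2 - N) - 1 = 2 * ((N:ℝ) - 2) - γ by ring] at this
  filter_upwards [ae_norm hN (fun r => 0 < r → U r = F r) (hUF.mono fun r h7 _ => h7)] with x hx hxR
  rw [hU x, hx (hR2.trans hxR)]
  exact key _ hxR
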